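/- Let X be a finitely generated Λ-module and set ω_m^+ = ∏_{0≤n≤m, n even} Φ_n. Assume that: (i) for every m ≥ 0 the p-power torsion submodule (X/ω_m^+X)[p^∞] is finite; and (ii) for every m ≥ 0 there exists m′ ≥ m such that the homomorphism (X/ω_{m′}^+X)[p^∞] → (X/ω_m^+X)[p^∞] induced by the natural projection X/ω_{m′}^+X → X/ω_m^+X is the zero map (equivalently, the inverse limit of the finite groups (X/ω_m^+X)[p^∞] vanishes). Then there exist an integer r ≥ 0, a finite set I of even non-negative integers, positive integers t_n for n ∈ I, and an injective Λ-module homomorphism X → Λ^r ⊕ (⊕_{n∈I} (Λ/Φ_nΛ)^{t_n}) with finite cokernel. -/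

import Mathlib

/-- `Φ_n ∈ Λ = ℤ_p⟦T⟧`: the `p^n`-th cyclotomic polynomial evaluated at `1 + T`. -/
noncomputable def PhiLT (p : ℕ) [Fact p.Prime] (n : ℕ) : PowerSeries ℤ_[p] :=
  (((Polynomial.cyclotomic (p ^ n) ℤ_[p]).comp (Polynomial.X + 1) : Polynomial ℤ_[p]) :
    PowerSeries ℤ_[p])

/-- `ω_m^+ = ∏_{0 ≤ n ≤ m, n even} Φ_n ∈ Λ`. -/
noncomputable def omegaPlus (p : ℕ) [Fact p.Prime] (m : ℕ) : PowerSeries ℤ_[p] :=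
  ∏ n ∈ (Finset.range (m + 1)).filter (fun n => Even n), PhiLT p n

section LocalAlgebra

open IsLocalRing

variable {A : Type*} [CommRing A]

theorem exists_linearMap_ker_eq_torsion [IsDomain A] (M : Type*) [AddCommGroup M] [Module A M]
    [Module.Finite A M] :
    ∃ (s : ℕ) (f : M →ₗ[A] (Fin s → A)), ∀ x, f x = 0 ↔ ∃ a : A, a ≠ 0 ∧ a • x = 0 := by
  classical
  obtain ⟨n, g, hg⟩ := Module.Finite.exists_fin' A M
  let v : Fin n → M := fun i => g (Pi.single i 1)
  obtain ⟨s, hs, hs'⟩ := exists_maximal_linearIndepOn A v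
  have key : ∀ i, ∃ a : A, a ≠ 0 ∧ a • v i ∈ Submodule.span A (v '' s) := by
    intro i
    by_cases hi : i ∈ s
    · exact ⟨1, one_ne_zero, by
        rw [one_smul]; exact Submodule.subset_span (Set.mem_image_of_mem _ hi)⟩
    · exact hs' i hi
  choose a ha0 ha using key
  let d := ∏ i, a i
  have hd0 : d ≠ 0 := Finset.prod_ne_zero_iff.2 fun i _ => ha0 i
  have hd : ∀ x : M, d • x ∈ Submodule.span A (Set.range fun i : s => v i) := by
    intro x
    obtain ⟨c, rfl⟩ := hg x
    rw [pi_eq_sum_univ' c, map_sum, Finset.smul_sum]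
    refine Submodule.sum_mem _ fun i _ => ?_
    rw [map_smul, smul_comm]
    refine Submodule.smul_mem _ _ ?_
    have : d = (∏ j ∈ Finset.univ.erase i, a j) * a i :=
      (Finset.prod_erase_mul _ _ (Finset.mem_univ i)).symm
    rw [this, mul_smul]
    refine Submodule.smul_mem _ _ ?_
    have h := ha i
    rw [Set.image_eq_range] at h
    exact h
  let e : (s →₀ A) ≃ₗ[A] (Fin (Fintype.card s) → A) :=
    (Finsupp.linearEquivFunOnFinite A A s).trans
      (LinearEquiv.funCongrLeft A A (Fintype.equivFin s).symm)
  refine ⟨Fintype.card s, e.toLinearMap ∘ₗ hs.linearIndependent.repr ∘ₗ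
    ((LinearMap.lsmul A M d).codRestrict _ hd), fun x => ⟨fun h => ⟨d, hd0, ?_⟩, ?_⟩⟩
  · have h2 := (LinearMap.ker_eq_bot'.1 hs.linearIndependent.repr_ker) _
      (e.map_eq_zero_iff.1 (by simpa using h))
    exact congrArg Subtype.val h2
  · rintro ⟨b, hb, hbx⟩
    have : b • (e.toLinearMap ∘ₗ hs.linearIndependent.repr ∘ₗ
      ((LinearMap.lsmul A M d).codRestrict _ hd)) x = 0 := by
      rw [← map_smul, hbx, map_zero]
    exact (smul_eq_zero.1 this).resolve_left hb

theorem exists_surjective_ker_le_maximalIdeal [IsLocalRing A] (M : Type*) [AddCommGroup M]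
    [Module A M] [Module.Finite A M] :
    ∃ (t : ℕ) (f : (Fin t → A) →ₗ[A] M), Function.Surjective f ∧
      ∀ q, f q = 0 → ∀ i, q i ∈ maximalIdeal A := by
  let w := Module.finBasis (ResidueField A) (TensorProduct A (ResidueField A) M)
  obtain ⟨v, hv⟩ := (TensorProduct.mk_surjective A M (ResidueField A)
    Ideal.Quotient.mk_surjective).comp_left w
  refine ⟨_, Fintype.linearCombination A v, ?_, fun q hq i => ?_⟩
  · rw [← LinearMap.range_eq_top, Fintype.range_linearCombination]
    exact span_eq_top_of_tmul_eq_basis v w fun i => congrFun hv i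
  · have h : ∑ i, residue A (q i) • w i = 0 := by
      have := congrArg (TensorProduct.mk A (ResidueField A) M 1) hq
      rw [Fintype.linearCombination_apply, map_sum, map_zero] at this
      rw [← this]
      refine Finset.sum_congr rfl fun i _ => ?_
      rw [map_smul, ← congrFun hv i]
      exact (algebraMap_smul (ResidueField A) (q i) _)
    have := Fintype.linearIndependent_iff.1 w.linearIndependent _ h i
    exact (residue_eq_zero_iff _).1 this

theorem exists_smul_add_smul_of_forall_mem {x y : A} {t : ℕ} {q : Fin t → A}
    (hq : ∀ i, q i ∈ Ideal.span {x, y}) : ∃ a b : Fin t → A, q = x • a + y • b := by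
  choose a b h using fun i => Ideal.mem_span_pair.1 (hq i)
  exact ⟨a, b, funext fun i => by simp [← h i, mul_comm]⟩

/-- A finite module of depth two over a two-dimensional regular local ring is free. -/
theorem exists_linearEquiv_fin_of_regular_pair [IsLocalRing A] [IsNoetherianRing A] {x y : A}
    (hm : maximalIdeal A = Ideal.span {x, y}) (M : Type*) [AddCommGroup M] [Module A M]
    [Module.Finite A M] (hx : ∀ z : M, x • z = 0 → z = 0)
    (hy : ∀ z w : M, y • z = x • w → ∃ c, z = x • c) :
    ∃ r : ℕ, Nonempty (M ≃ₗ[A] (Fin r → A)) := by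
  obtain ⟨t, f, hf, hker⟩ := exists_surjective_ker_le_maximalIdeal (A := A) M
  have hxm : x ∈ maximalIdeal A := hm ▸ Ideal.subset_span (by simp)
  have hym : y ∈ maximalIdeal A := hm ▸ Ideal.subset_span (by simp)
  have : LinearMap.ker f = ⊥ := by
    refine Submodule.eq_bot_of_le_smul_of_le_jacobson_bot (maximalIdeal A) _
      (IsNoetherian.noetherian _) ?_ (maximalIdeal_le_jacobson _)
    intro q hq
    obtain ⟨a, b, rfl⟩ := exists_smul_add_smul_of_forall_mem fun i => hm ▸ hker q hq i
    have h0 : x • f a + y • f b = 0 := by simpa using hq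
    obtain ⟨c, hc⟩ := hy (f b) (-f a) (by
      rw [smul_neg]; exact (neg_eq_of_add_eq_zero_right h0).symm)
    obtain ⟨c, rfl⟩ := hf c
    have h1 : f (b - x • c) = 0 := by rw [map_sub, map_smul, hc, sub_self]
    have h2 : f (a + y • c) = 0 := by
      apply hx
      rw [map_add, map_smul, smul_add, smul_comm x y, ← hc, h0]
    have : x • a + y • b = x • (a + y • c) + y • (b - x • c) := by
      rw [smul_add, smul_sub, smul_comm x y]; abel
    rw [this]
    exact Submodule.add_mem _ (Submodule.smul_mem_smul hxm h2) (Submodule.smul_mem_smul hym h1)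
  exact ⟨t, ⟨(LinearEquiv.ofBijective f ⟨LinearMap.ker_eq_bot.1 this, hf⟩).symm⟩⟩

theorem exists_linearEquiv_fin_quotient [IsLocalRing A] [IsNoetherianRing A] {x φ : A}
    (hm : maximalIdeal A = Ideal.span {x, φ}) (M : Type*) [AddCommGroup M] [Module A M]
    [Module.Finite A M] (hx : ∀ z : M, x • z = 0 → z = 0) (hφ : ∀ z : M, φ • z = 0) :
    ∃ t : ℕ, Nonempty (M ≃ₗ[A] (Fin t → A ⧸ Ideal.span {φ})) := by
  obtain ⟨t, f, hf, hker⟩ := exists_surjective_ker_le_maximalIdeal (A := A) M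
  have hxm : x ∈ maximalIdeal A := hm ▸ Ideal.subset_span (by simp)
  let g : (Fin t → A) →ₗ[A] (Fin t → A ⧸ Ideal.span {φ}) :=
    LinearMap.pi fun i => (Ideal.span {φ}).mkQ ∘ₗ LinearMap.proj i
  have hg : Function.Surjective g := fun u => by
    choose v hv using fun i => Submodule.mkQ_surjective (Ideal.span {φ}) (u i)
    exact ⟨v, funext hv⟩
  have hgker : ∀ q, g q = 0 ↔ ∃ b, q = φ • b := by
    intro q
    constructor
    · intro h
      have : ∀ i, ∃ b, q i = φ * b := fun i => by
        have h1 : Ideal.Quotient.mk (Ideal.span {φ}) (q i) = 0 := congrFun h i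
        exact Ideal.mem_span_singleton.1 (Ideal.Quotient.eq_zero_iff_mem.1 h1)
      choose b hb using this
      exact ⟨b, funext hb⟩
    · rintro ⟨b, rfl⟩
      funext i
      exact Ideal.Quotient.eq_zero_iff_mem.2 (Ideal.mem_span_singleton.2 ⟨b i, rfl⟩)
  have hle : LinearMap.ker f ≤ LinearMap.ker g := by
    refine Submodule.le_of_le_smul_of_le_jacobson_bot (I := maximalIdeal A)
      (IsNoetherian.noetherian _) (maximalIdeal_le_jacobson _) ?_
    intro q hq
    obtain ⟨a, b, rfl⟩ := exists_smul_add_smul_of_forall_mem fun i => hm ▸ hker q hq i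
    have h0 : x • f a = 0 := by simpa [hφ] using hq
    rw [add_comm]
    exact Submodule.add_mem_sup ((hgker _).2 ⟨b, rfl⟩)
      (Submodule.smul_mem_smul hxm (hx _ h0))
  have heq : LinearMap.ker f = LinearMap.ker g := by
    refine le_antisymm hle fun q hq => ?_
    obtain ⟨b, rfl⟩ := (hgker q).1 hq
    rw [LinearMap.mem_ker, map_smul, hφ]
  exact ⟨t, ⟨(f.quotKerEquivOfSurjective hf).symm.trans
    ((Submodule.quotEquivOfEq _ _ heq).trans (g.quotKerEquivOfSurjective hg))⟩⟩

theorem finite_of_pow_smul_eq_zero [IsLocalRing A] [IsNoetherianRing A]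
    [Finite (ResidueField A)] {x y : A} (hm : maximalIdeal A = Ideal.span {x, y})
    (M : Type*) [AddCommGroup M] [Module A M] [Module.Finite A M] {k l : ℕ}
    (hx : ∀ z : M, x ^ k • z = 0) (hy : ∀ z : M, y ^ l • z = 0) : Finite M := by
  have hrad : maximalIdeal A ≤ (Ideal.span {x ^ k, y ^ l}).radical := by
    rw [hm, Ideal.span_le]
    rintro z (rfl | rfl)
    · exact ⟨k, Ideal.subset_span (by simp)⟩
    · exact ⟨l, Ideal.subset_span (by simp)⟩
  obtain ⟨N, hle⟩ := Ideal.exists_pow_le_of_le_radical_of_fg hrad (IsNoetherian.noetherian _)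
  have hfin : Finite (A ⧸ maximalIdeal A ^ N) := by
    have : Finite (A ⧸ maximalIdeal A) := ‹Finite (ResidueField A)›
    exact Ideal.finite_quotient_pow (IsNoetherian.noetherian _) _
  obtain ⟨n, g, hg⟩ := Module.Finite.exists_fin' A M
  have hkill : ∀ a ∈ maximalIdeal A ^ N, ∀ z : M, a • z = 0 := by
    intro a ha z
    obtain ⟨b, c, rfl⟩ := Ideal.mem_span_pair.1 (hle ha)
    rw [add_smul, mul_smul, mul_smul, hx, hy, smul_zero, smul_zero, add_zero]
  choose s hs using Ideal.Quotient.mk_surjective (I := maximalIdeal A ^ N)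
  refine Finite.of_surjective
    (fun u : Fin n → A ⧸ maximalIdeal A ^ N => g fun i => s (u i)) fun z => ?_
  obtain ⟨v, rfl⟩ := hg z
  refine ⟨fun i => Ideal.Quotient.mk _ (v i), ?_⟩
  rw [← sub_eq_zero]
  change g _ - g v = 0
  rw [← map_sub, pi_eq_sum_univ' (_ - v), map_sum]
  refine Finset.sum_eq_zero fun i _ => ?_
  rw [map_smul]
  exact hkill _ (Ideal.Quotient.eq.1 (hs _)) _

/-- A finite module over a two-dimensional regular local ring maps to a free module, with kernel
its torsion and with cokernel killed by powers of both parameters. -/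
theorem exists_linearMap_fin_saturated [IsDomain A] [IsLocalRing A] [IsNoetherianRing A] {x y : A}
    (hm : maximalIdeal A = Ideal.span {x, y}) (hx0 : x ≠ 0)
    (hxy : ∀ a b : A, y * a = x * b → x ∣ a) (M : Type*) [AddCommGroup M] [Module A M]
    [Module.Finite A M] :
    ∃ (r : ℕ) (f : M →ₗ[A] (Fin r → A)), (∀ z, f z = 0 ↔ ∃ a : A, a ≠ 0 ∧ a • z = 0) ∧
      ∃ k : ℕ, ∀ v, (∃ z, f z = x ^ k • v) ∧ ∃ z, f z = y ^ k • v := by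
  obtain ⟨s, f, hf⟩ := exists_linearMap_ker_eq_torsion (A := A) M
  have hmono : ∀ (u : A) {j k : ℕ}, j ≤ k → ∀ v : Fin s → A, u ^ j • v ∈ LinearMap.range f →
      u ^ k • v ∈ LinearMap.range f := by
    intro u j k hjk v hv
    obtain ⟨i, rfl⟩ := Nat.exists_eq_add_of_le' hjk
    rw [pow_add, mul_smul]
    exact Submodule.smul_mem _ _ hv
  let S : Submodule A (Fin s → A) :=
    { carrier := {v | ∃ k : ℕ, x ^ k • v ∈ LinearMap.range f ∧ y ^ k • v ∈ LinearMap.range f}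
      zero_mem' := ⟨0, by simp, by simp⟩
      add_mem' := by
        rintro v w ⟨j, hj, hj'⟩ ⟨k, hk, hk'⟩
        refine ⟨j + k, ?_, ?_⟩ <;> rw [smul_add]
        · exact add_mem (hmono _ (Nat.le_add_right _ _) _ hj) (hmono _ (Nat.le_add_left _ _) _ hk)
        · exact add_mem (hmono _ (Nat.le_add_right _ _) _ hj') (hmono _ (Nat.le_add_left _ _) _ hk')
      smul_mem' := by
        rintro c v ⟨k, hk, hk'⟩
        refine ⟨k, ?_, ?_⟩ <;> rw [smul_comm]
        · exact Submodule.smul_mem _ _ hk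
        · exact Submodule.smul_mem _ _ hk' }
  have hfS : ∀ z, f z ∈ S := fun z => ⟨0, by simp, by simp⟩
  obtain ⟨r, ⟨e⟩⟩ := exists_linearEquiv_fin_of_regular_pair hm S
    (fun z hz => (smul_eq_zero.1 hz).resolve_left hx0) (by
      rintro ⟨z, hz⟩ ⟨w, k, hw, hw'⟩ h
      have h1 : y • z = x • w := congrArg Subtype.val h
      choose c hc using fun i => hxy (z i) (w i) (congrFun h1 i)
      have hzc : z = x • c := funext hc
      have hwc : w = y • c := by
        subst hzc
        refine smul_right_injective _ hx0 ?_
        change x • w = x • y • c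
        rw [← h1, smul_comm]
      obtain ⟨j, hj, -⟩ := hz
      refine ⟨⟨c, j + 1 + (k + 1), ?_, ?_⟩, Subtype.ext hzc⟩
      · refine hmono _ (Nat.le_add_right _ _) _ ?_
        rw [pow_succ, mul_smul, ← hzc]
        exact hj
      · refine hmono _ (Nat.le_add_left _ _) _ ?_
        rw [pow_succ, mul_smul, ← hwc]
        exact hw')
  have hS : ∀ i, ∃ k : ℕ, x ^ k • (e.symm (Pi.single i 1) : Fin s → A) ∈ LinearMap.range f ∧
      y ^ k • (e.symm (Pi.single i 1) : Fin s → A) ∈ LinearMap.range f :=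
    fun i => (e.symm (Pi.single i 1)).2
  choose k hk hk' using hS
  have hle : ∀ i, k i ≤ ∑ j, k j := fun i =>
    Finset.single_le_sum (fun _ _ => Nat.zero_le _) (Finset.mem_univ i)
  have main : ∀ u : A, (∀ i, u ^ k i • (e.symm (Pi.single i 1) : Fin s → A) ∈ LinearMap.range f) →
      ∀ v, ∃ z, e (f.codRestrict S hfS z) = u ^ (∑ j, k j) • v := by
    intro u hu v
    have : u ^ (∑ j, k j) • (e.symm v : Fin s → A) ∈ LinearMap.range f := by
      rw [pi_eq_sum_univ' v, map_sum, Submodule.coe_sum, Finset.smul_sum]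
      refine Submodule.sum_mem _ fun i _ => ?_
      rw [map_smul, Submodule.coe_smul, smul_comm]
      exact Submodule.smul_mem _ _ (hmono _ (hle i) _ (hu i))
    obtain ⟨z, hz⟩ := this
    refine ⟨z, ?_⟩
    rw [← e.apply_symm_apply v, ← map_smul]
    congr 1
    exact Subtype.ext (by simpa using hz)
  refine ⟨r, e.toLinearMap ∘ₗ f.codRestrict S hfS, fun z => ?_, ∑ j, k j,
    fun v => ⟨main x hk v, main y hk' v⟩⟩
  rw [← hf]
  change e (f.codRestrict S hfS z) = 0 ↔ _
  rw [e.map_eq_zero_iff, Subtype.ext_iff]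
  rfl

theorem exists_pow_eq_mul_add_mul [IsLocalRing A] [IsNoetherianRing A] {x φ : A}
    (hm : maximalIdeal A = Ideal.span {x, φ}) {g : A} (hg : ¬ φ ∣ g) :
    ∃ (k : ℕ) (a b : A), x ^ k = a * g + b * φ := by
  classical
  have hex : ∃ k, g ∉ Ideal.span {x ^ k, φ} := by
    by_contra! hall
    have hmem : Ideal.Quotient.mk (Ideal.span {φ}) g ∈
        (⨅ i : ℕ, maximalIdeal A ^ i • ⊤ : Submodule A (A ⧸ Ideal.span {φ})) := by
      rw [Submodule.mem_iInf]
      intro i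
      obtain ⟨a, b, rfl⟩ := Ideal.mem_span_pair.1 (hall i)
      have : Ideal.Quotient.mk (Ideal.span {φ}) (a * x ^ i + b * φ) =
          x ^ i • Ideal.Quotient.mk (Ideal.span {φ}) a := by
        rw [Algebra.smul_def, Ideal.Quotient.algebraMap_eq, ← map_mul, Ideal.Quotient.eq]
        exact Ideal.mem_span_singleton.2 ⟨b, by ring⟩
      rw [this]
      exact Submodule.smul_mem_smul
        (Ideal.pow_mem_pow (hm ▸ Ideal.subset_span (by simp)) i) trivial
    rw [Ideal.iInf_pow_smul_eq_bot_of_isLocalRing _ (maximalIdeal.isMaximal A).ne_top,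
      Submodule.mem_bot, Ideal.Quotient.eq_zero_iff_dvd] at hmem
    exact hg hmem
  obtain ⟨k, hk, hmin⟩ : ∃ k, g ∉ Ideal.span {x ^ k, φ} ∧ ∀ j < k, g ∈ Ideal.span {x ^ j, φ} :=
    ⟨Nat.find hex, Nat.find_spec hex, fun j hj => not_not.1 (Nat.find_min hex hj)⟩
  rcases k with _ | j
  · exact absurd (Ideal.mem_span_pair.2 ⟨g, 0, by simp⟩) hk
  obtain ⟨u, b, rfl⟩ := Ideal.mem_span_pair.1 (hmin j j.lt_succ_self)
  have hu : IsUnit u := by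
    by_contra hu
    obtain ⟨c, d, rfl⟩ := Ideal.mem_span_pair.1 (hm ▸ (mem_maximalIdeal u).2 hu)
    exact hk (Ideal.mem_span_pair.2 ⟨c, d * x ^ j + b, by ring⟩)
  obtain ⟨v, hv⟩ := hu.exists_left_inv
  exact ⟨j, v, -(v * b), by linear_combination (-x ^ j) * hv⟩

theorem finite_setOf_dvd_of_pairwise [IsDomain A] [IsLocalRing A] [IsNoetherianRing A] {ι : Type*}
    {p : A} (hp : Prime p) {φ : ι → A} (hφ : ∀ i, φ i ∈ maximalIdeal A) (hpφ : ∀ i, ¬ p ∣ φ i)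
    (hpair : ∀ i j, i ≠ j → ∃ a b, p = a * φ i + b * φ j) {g : A} (hg : g ≠ 0) :
    {i | φ i ∣ g}.Finite := by
  classical
  have cancel : ∀ (i : ι) (k : ℕ) (h : A), φ i ∣ p ^ k * h → φ i ∣ h := by
    intro i k h ⟨c, hc⟩
    obtain ⟨d, rfl⟩ : p ^ k ∣ c := (hp.pow_dvd_of_dvd_mul_left k (hpφ i) ⟨h, hc.symm⟩)
    exact ⟨d, mul_left_cancel₀ (pow_ne_zero k hp.ne_zero) (by rw [hc]; ring)⟩
  have hprod : ∀ s : Finset ι, ∀ j ∉ s, ∃ (k : ℕ) (a b : A),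
      p ^ k = a * ∏ i ∈ s, φ i + b * φ j := by
    intro s
    induction s using Finset.induction_on with
    | empty => exact fun j _ => ⟨0, 1, 0, by simp⟩
    | insert i s his ih =>
      intro j hj
      rw [Finset.mem_insert, not_or] at hj
      obtain ⟨k, a, b, h⟩ := ih j hj.2
      obtain ⟨c, d, h'⟩ := hpair i j (Ne.symm hj.1)
      refine ⟨k + 1, a * c, a * (∏ i ∈ s, φ i) * d + b * p, ?_⟩
      rw [pow_succ, Finset.prod_insert his]
      linear_combination p * h + a * (∏ i ∈ s, φ i) * h'
  have hdvd : ∀ s : Finset ι, (∀ i ∈ s, φ i ∣ g) → ∏ i ∈ s, φ i ∣ g := by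
    intro s
    induction s using Finset.induction_on with
    | empty => simp
    | insert i s his ih =>
      intro hs
      obtain ⟨h, hh⟩ := ih fun j hj => hs j (Finset.mem_insert_of_mem hj)
      obtain ⟨c, hc⟩ := hs i (Finset.mem_insert_self _ _)
      obtain ⟨k, a, b, hk⟩ := hprod s i his
      have : φ i ∣ h := cancel i k h
        ⟨a * c + b * h, by linear_combination h * hk - a * hh + a * hc⟩
      rw [Finset.prod_insert his, mul_comm, hh]
      exact mul_dvd_mul_left _ this
  by_contra hinf
  apply hg
  have : g ∈ (⨅ i : ℕ, maximalIdeal A ^ i) := by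
    rw [Submodule.mem_iInf]
    intro n
    obtain ⟨s, hs, rfl⟩ := Set.Infinite.exists_subset_card_eq hinf n
    refine Ideal.mem_of_dvd _ (hdvd s fun i hi => hs hi) ?_
    rw [← Finset.prod_const]
    exact Ideal.prod_mem_prod fun i _ => hφ i
  rwa [Ideal.iInf_pow_eq_bot_of_isLocalRing _ (maximalIdeal.isMaximal A).ne_top] at this

end LocalAlgebra

section CyclotomicTorsion

open IsLocalRing

variable {A : Type*} [CommRing A]

theorem exists_pow_eq_sum_mul_prod_erase {ι : Type*} [DecidableEq ι] {p : A} {φ : ι → A}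
    (hpair : ∀ i j, i ≠ j → ∃ a b, p = a * φ i + b * φ j) (I : Finset ι) :
    ∃ (k : ℕ) (a : ι → A) (b : A),
      p ^ k = ∑ i ∈ I, a i * ∏ j ∈ I.erase i, φ j + b * ∏ j ∈ I, φ j := by
  induction I using Finset.induction_on with
  | empty => exact ⟨0, 0, 1, by simp⟩
  | insert m I hm ih =>
    obtain ⟨k, a, b, h⟩ := ih
    have hcop : ∀ s : Finset ι, m ∉ s → ∃ (l : ℕ) (u v : A),
        p ^ l = u * ∏ j ∈ s, φ j + v * φ m := by
      intro s
      induction s using Finset.induction_on with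
      | empty => exact fun _ => ⟨0, 1, 0, by simp⟩
      | insert i s his ihs =>
        intro hms
        rw [Finset.mem_insert, not_or] at hms
        obtain ⟨l, u, v, h1⟩ := ihs hms.2
        obtain ⟨c, d, h2⟩ := hpair i m (Ne.symm hms.1)
        refine ⟨l + 1, u * c, u * (∏ j ∈ s, φ j) * d + v * p, ?_⟩
        rw [pow_succ, Finset.prod_insert his]
        linear_combination p * h1 + u * (∏ j ∈ s, φ j) * h2
    obtain ⟨l, u, v, hl⟩ := hcop I hm
    refine ⟨k + l, fun i => if i = m then
      (u * ∑ i ∈ I, a i * ∏ j ∈ I.erase i, φ j) + b * p ^ l else a i * v, 0, ?_⟩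
    have hsum : ∑ i ∈ I, (if i = m then (u * ∑ i ∈ I, a i * ∏ j ∈ I.erase i, φ j) + b * p ^ l
        else a i * v) * ∏ j ∈ (insert m I).erase i, φ j =
        v * φ m * ∑ i ∈ I, a i * ∏ j ∈ I.erase i, φ j := by
      conv_rhs => rw [Finset.mul_sum]
      refine Finset.sum_congr rfl fun i hi => ?_
      have him : i ≠ m := fun h => hm (h ▸ hi)
      rw [if_neg him, Finset.erase_insert_of_ne him.symm, Finset.prod_insert]
      · ring
      · exact fun h => hm (Finset.mem_of_mem_erase h)
    rw [Finset.sum_insert hm, hsum, Finset.erase_insert hm, pow_add]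
    simp only [if_true]
    linear_combination p ^ l * h + (∑ i ∈ I, a i * ∏ j ∈ I.erase i, φ j) * hl

/-- The submodule of those elements with some `p`-power multiple in `φ M`. -/
def saturatedMultiples (p φ : A) (M : Type*) [AddCommGroup M] [Module A M] : Submodule A M where
  carrier := {z | ∃ (k : ℕ) (w : M), p ^ k • z = φ • w}
  zero_mem' := ⟨0, 0, by simp⟩
  add_mem' := by
    rintro y z ⟨j, v, hv⟩ ⟨k, w, hw⟩
    refine ⟨j + k, p ^ k • v + p ^ j • w, ?_⟩
    rw [smul_add, smul_add, smul_comm φ, smul_comm φ, ← hv, ← hw, smul_smul, smul_smul, ← pow_add,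
      ← pow_add, add_comm k j]
  smul_mem' := by
    rintro c z ⟨k, w, hw⟩
    exact ⟨k, c • w, by rw [smul_comm, hw, smul_comm]⟩

theorem exists_linearMap_pi_quotient [IsLocalRing A] [IsNoetherianRing A] {ι : Type*}
    {p : A} (hp : p ∈ maximalIdeal A) {φ x : ι → A}
    (hm : ∀ i, maximalIdeal A = Ideal.span {x i, φ i})
    (hpair : ∀ i j, i ≠ j → ∃ a b, p = a * φ i + b * φ j)
    (M : Type*) [AddCommGroup M] [Module A M] [Module.Finite A M]
    (hpM : ∀ z : M, p • z = 0 → z = 0) (I : Finset ι) (hI : ∀ z : M, (∏ i ∈ I, φ i) • z = 0) :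
    ∃ (t : ι → ℕ) (g : M →ₗ[A] ((i : I) → Fin (t i) → A ⧸ Ideal.span {φ i})),
      Function.Injective g ∧ ∃ k : ℕ, ∀ v, ∃ z, g z = p ^ k • v := by
  classical
  have hpow : ∀ (k : ℕ) (z : M), p ^ k • z = 0 → z = 0 := by
    intro k
    induction k with
    | zero => simp
    | succ k ih => exact fun z hz => hpM z (ih _ (by rwa [smul_smul, ← pow_succ]))
  have hfree : ∀ i, ∃ t : ℕ,
      Nonempty ((M ⧸ saturatedMultiples p (φ i) M) ≃ₗ[A] (Fin t → A ⧸ Ideal.span {φ i})) := by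
    intro i
    have hφ : ∀ z : M ⧸ saturatedMultiples p (φ i) M, φ i • z = 0 := by
      intro z
      obtain ⟨z, rfl⟩ := Submodule.mkQ_surjective _ z
      rw [← map_smul]
      exact (Submodule.Quotient.mk_eq_zero _).2 ⟨0, z, by simp⟩
    refine exists_linearEquiv_fin_quotient (hm i) _ (fun z hz => ?_) hφ
    obtain ⟨a, b, hab⟩ := Ideal.mem_span_pair.1 ((hm i) ▸ hp)
    have hpz : p • z = 0 := by
      have h := congrArg (· • z) hab
      rw [← h, add_smul, mul_smul, mul_smul, hz, hφ, smul_zero, smul_zero, add_zero]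
    obtain ⟨z, rfl⟩ := Submodule.mkQ_surjective _ z
    rw [← map_smul] at hpz
    obtain ⟨k, w, hw⟩ := (Submodule.Quotient.mk_eq_zero _).1 hpz
    exact (Submodule.Quotient.mk_eq_zero _).2 ⟨k + 1, w, by rw [pow_succ, mul_smul, hw]⟩
  choose t e using hfree
  let e' := fun i => (e i).some
  let g : M →ₗ[A] ((i : I) → Fin (t i) → A ⧸ Ideal.span {φ i}) :=
    LinearMap.pi fun i => (e' i).toLinearMap ∘ₗ (saturatedMultiples p (φ i) M).mkQ
  obtain ⟨k, a, b, hk⟩ := exists_pow_eq_sum_mul_prod_erase hpair I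
  refine ⟨t, g, ?_, k, fun v => ?_⟩
  · rw [injective_iff_map_eq_zero]
    intro z hz
    refine hpow k z ?_
    rw [hk, add_smul, Finset.sum_smul, mul_smul b, hI, smul_zero, add_zero]
    refine Finset.sum_eq_zero fun i hi => ?_
    have hzi : e' i ((saturatedMultiples p (φ i) M).mkQ z) = 0 := congrFun hz ⟨i, hi⟩
    rw [(e' i).map_eq_zero_iff] at hzi
    obtain ⟨l, w, hw⟩ := (Submodule.Quotient.mk_eq_zero _).1 hzi
    rw [mul_smul]
    refine (smul_eq_zero_of_right _ (hpow l _ ?_))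
    rw [smul_comm, hw, smul_smul, Finset.prod_erase_mul _ _ hi, hI]
  · choose y hy using fun i : I => Submodule.mkQ_surjective _ ((e' i).symm (v i))
    refine ⟨∑ i : I, (a i * ∏ j ∈ I.erase i, φ j) • y i, ?_⟩
    have hkill : ∀ (i : I) (w : Fin (t i) → A ⧸ Ideal.span {φ i}), φ i • w = 0 := by
      intro i w
      funext s
      obtain ⟨u, hu⟩ := Ideal.Quotient.mk_surjective (w s)
      rw [Pi.smul_apply, ← hu]
      exact Ideal.Quotient.eq_zero_iff_mem.2 (Ideal.mem_span_singleton.2 ⟨u, rfl⟩)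
    have hkill' : ∀ (i : I) (c : A), φ i ∣ c → ∀ w : Fin (t i) → A ⧸ Ideal.span {φ i},
        c • w = 0 := by
      rintro i c ⟨d, rfl⟩ w
      rw [mul_smul, hkill]
    funext i
    have hgi : ∀ z, g z i = e' i ((saturatedMultiples p (φ i) M).mkQ z) := fun z => rfl
    have hgy : g (y i) i = v i := by rw [hgi, hy, LinearEquiv.apply_symm_apply]
    rw [map_sum, Finset.sum_apply, Finset.sum_eq_single i]
    · rw [map_smul, Pi.smul_apply, hgy, Pi.smul_apply, hk, add_smul,
        hkill' i (b * _) ((Finset.dvd_prod_of_mem φ i.2).mul_left b), add_zero, Finset.sum_smul,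
        Finset.sum_eq_single i.1]
      · intro j hj hji
        exact hkill' i _ ((Finset.dvd_prod_of_mem φ (Finset.mem_erase.2 ⟨hji.symm, i.2⟩)).mul_left _) _
      · exact fun h => absurd i.2 h
    · intro j _ hji
      rw [map_smul, Pi.smul_apply]
      exact hkill' i _ ((Finset.dvd_prod_of_mem φ (Finset.mem_erase.2
        ⟨fun h => hji (Subtype.ext h.symm), i.2⟩)).mul_left _) _
    · exact fun h => absurd (Finset.mem_univ i) h

theorem exists_linearMap_pi_quotient_pos [IsLocalRing A] [IsNoetherianRing A] {ι : Type*}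
    {p : A} (hp : p ∈ maximalIdeal A) {φ x : ι → A}
    (hm : ∀ i, maximalIdeal A = Ideal.span {x i, φ i})
    (hpair : ∀ i j, i ≠ j → ∃ a b, p = a * φ i + b * φ j)
    (M : Type*) [AddCommGroup M] [Module A M] [Module.Finite A M]
    (hpM : ∀ z : M, p • z = 0 → z = 0) (I : Finset ι) (hI : ∀ z : M, (∏ i ∈ I, φ i) • z = 0) :
    ∃ (J : Finset ι) (t : ι → ℕ) (g : M →ₗ[A] ((i : J) → Fin (t i) → A ⧸ Ideal.span {φ i})),
      J ⊆ I ∧ (∀ i ∈ J, 1 ≤ t i) ∧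
      Function.Injective g ∧ ∃ k : ℕ, ∀ v, ∃ z, g z = p ^ k • v := by
  classical
  obtain ⟨t, g, hg, k, hk⟩ := exists_linearMap_pi_quotient hp hm hpair M hpM I hI
  let J := I.filter fun i => 1 ≤ t i
  have hJI : J ⊆ I := Finset.filter_subset _ _
  let ρ : ((i : I) → Fin (t i) → A ⧸ Ideal.span {φ i}) →ₗ[A]
      ((i : J) → Fin (t i) → A ⧸ Ideal.span {φ i}) :=
    LinearMap.pi fun i => LinearMap.proj (⟨i.1, hJI i.2⟩ : I)
  refine ⟨J, t, ρ ∘ₗ g, hJI, fun i hi => (Finset.mem_filter.1 hi).2, ?_, k, fun v => ?_⟩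
  · have hρ : Function.Injective ρ := ?_
    · exact hρ.comp hg
    intro u v huv
    funext i s
    have hi : i.1 ∈ J := Finset.mem_filter.2 ⟨i.2, s.pos⟩
    exact congrFun (congrFun huv ⟨i.1, hi⟩) s
  · obtain ⟨z, hz⟩ := hk fun i => if h : i.1 ∈ J then v ⟨i.1, h⟩ else 0
    refine ⟨z, ?_⟩
    rw [LinearMap.comp_apply, hz, map_smul]
    congr 1
    funext i
    exact dif_pos i.2

end CyclotomicTorsion

section StructureTheorem

open IsLocalRing

variable {A : Type*} [CommRing A]

theorem exists_pow_eq_mul_add_mul_prod {ι : Type*} {p x : A} {φ : ι → A}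
    (hxφ : ∀ i, ∃ (n : ℕ) (a b : A), x ^ n = a * p + b * φ i) (J : Finset ι) (m : ℕ) :
    ∃ (n : ℕ) (a b : A), x ^ n = a * p ^ m + b * ∏ i ∈ J, φ i := by
  classical
  have h1 : ∃ (n : ℕ) (a b : A), x ^ n = a * p + b * ∏ i ∈ J, φ i := by
    induction J using Finset.induction_on with
    | empty => exact ⟨0, 0, 1, by simp⟩
    | insert i J hi ih =>
      obtain ⟨n, a, b, h⟩ := ih
      obtain ⟨l, c, d, h'⟩ := hxφ i
      refine ⟨n + l, a * x ^ l + b * (∏ i ∈ J, φ i) * c, b * d, ?_⟩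
      rw [pow_add, Finset.prod_insert hi]
      linear_combination x ^ l * h + b * (∏ i ∈ J, φ i) * h'
  obtain ⟨n, a, b, h⟩ := h1
  have h2 : (∏ i ∈ J, φ i) ∣ (x ^ n) ^ m - (a * p) ^ m :=
    (Dvd.intro_left b (by linear_combination -h)).trans (sub_dvd_pow_sub_pow (x ^ n) (a * p) m)
  obtain ⟨c, hc⟩ := h2
  exact ⟨n * m, a ^ m, c, by rw [pow_mul, ← mul_pow]; linear_combination hc⟩

/-- If the elements of `M` that are, up to `p`-power torsion, divisible by all finite products of
the `φ i` vanish, then the torsion of `M` is killed by such a product. -/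
theorem exists_prod_smul_torsion_eq_zero [IsDomain A] [IsLocalRing A] [IsNoetherianRing A]
    {p : A} (hp : Prime p) {ι : Type*} {φ y : ι → A}
    (hmφ : ∀ i, maximalIdeal A = Ideal.span {y i, φ i}) (hpm : p ∈ maximalIdeal A)
    (hpφ : ∀ i, ¬ p ∣ φ i)
    (hpair : ∀ i j, i ≠ j → ∃ a b, p = a * φ i + b * φ j) (E : Set ι)
    {M : Type*} [AddCommGroup M] [Module A M]
    (hker : ∀ z : M, (∀ s : Finset ι, (∀ i ∈ s, i ∈ E) →
      ∃ (k : ℕ) (w : M), p ^ k • z = (∏ i ∈ s, φ i) • w) → z = 0) {g : A} (hg : g ≠ 0) :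
    ∃ I : Finset ι, (∀ i ∈ I, i ∈ E) ∧ ∀ z : M, g • z = 0 → (∏ i ∈ I, φ i) • z = 0 := by
  classical
  have hfin := finite_setOf_dvd_of_pairwise hp
    (fun i => (hmφ i) ▸ Ideal.subset_span (by simp)) hpφ hpair hg
  have hfinE : {i | i ∈ E ∧ φ i ∣ g}.Finite := hfin.subset fun i hi => hi.2
  let I := hfinE.toFinset
  have hI : ∀ i, i ∈ I ↔ i ∈ E ∧ φ i ∣ g := fun i => hfinE.mem_toFinset
  refine ⟨I, fun i hi => ((hI i).1 hi).1, fun z hz => hker _ fun s hs => ?_⟩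
  have hdiv : ∀ s : Finset ι, (∀ i ∈ s, i ∈ E ∧ i ∉ I) →
      ∃ (k : ℕ) (b : A), p ^ k • z = (∏ i ∈ s, φ i) • b • z := by
    intro s
    induction s using Finset.induction_on with
    | empty => exact fun _ => ⟨0, 1, by simp⟩
    | insert i s his ih =>
      intro hs
      obtain ⟨k, b, hk⟩ := ih fun j hj => hs j (Finset.mem_insert_of_mem hj)
      obtain ⟨hiE, hiI⟩ := hs i (Finset.mem_insert_self _ _)
      obtain ⟨j, a, c, hj⟩ := exists_pow_eq_mul_add_mul (hmφ i) fun h => hiI ((hI i).2 ⟨hiE, h⟩)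
      obtain ⟨u, v, huv⟩ := Ideal.mem_span_pair.1 ((hmφ i) ▸ hpm)
      obtain ⟨d, hd⟩ : φ i ∣ p ^ j - (u * y i) ^ j :=
        (Dvd.intro_left v (by linear_combination huv)).trans (sub_dvd_pow_sub_pow _ _ _)
      have hpj : p ^ j = (u ^ j * a) * g + φ i * (u ^ j * c + d) := by
        rw [mul_pow] at hd
        linear_combination hd + u ^ j * hj
      refine ⟨j + k, (u ^ j * c + d) * b, ?_⟩
      have hz' : p ^ j • z = (φ i * (u ^ j * c + d)) • z := by
        rw [hpj, add_smul, mul_smul _ g, hz, smul_zero, zero_add]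
      rw [pow_add, mul_smul, hk, smul_comm, smul_comm (p ^ j) b, hz', Finset.prod_insert his]
      simp only [smul_smul]
      congr 1
      ring
  obtain ⟨k, b, hk⟩ := hdiv (s \ I) fun i hi =>
    ⟨hs i (Finset.mem_sdiff.1 hi).1, (Finset.mem_sdiff.1 hi).2⟩
  refine ⟨k, (∏ i ∈ I \ s, φ i) • b • z, ?_⟩
  rw [smul_comm, hk, ← Finset.prod_inter_mul_prod_sdiff I s φ,
    ← Finset.prod_inter_mul_prod_sdiff s I φ, Finset.inter_comm s I]
  simp only [smul_smul]
  congr 1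
  ring

theorem exists_injective_finite_cokernel [IsDomain A] [IsLocalRing A] [IsNoetherianRing A]
    [Finite (ResidueField A)] {p x : A} (hp : Prime p)
    (hm : maximalIdeal A = Ideal.span {p, x}) (hpx : ¬ p ∣ x) {ι : Type*} {φ y : ι → A}
    (hmφ : ∀ i, maximalIdeal A = Ideal.span {y i, φ i})
    (hpair : ∀ i j, i ≠ j → ∃ a b, p = a * φ i + b * φ j)
    (hxφ : ∀ i, ∃ (n : ℕ) (a b : A), x ^ n = a * p + b * φ i) (E : Set ι)
    (M : Type*) [AddCommGroup M] [Module A M] [Module.Finite A M]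
    (hker : ∀ z : M, (∀ s : Finset ι, (∀ i ∈ s, i ∈ E) →
      ∃ (k : ℕ) (w : M), p ^ k • z = (∏ i ∈ s, φ i) • w) → z = 0) :
    ∃ (r : ℕ) (J : Finset ι) (t : ι → ℕ), (∀ i ∈ J, i ∈ E) ∧ (∀ i ∈ J, 1 ≤ t i) ∧
      ∃ F : M →ₗ[A] ((Fin r → A) × ((i : J) → Fin (t i) → A ⧸ Ideal.span {φ i})),
        Function.Injective F ∧ Finite
          (((Fin r → A) × ((i : J) → Fin (t i) → A ⧸ Ideal.span {φ i})) ⧸ LinearMap.range F) := by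
  classical
  have hpm : p ∈ maximalIdeal A := hm ▸ Ideal.subset_span (by simp)
  have hpM : ∀ z : M, p • z = 0 → z = 0 := fun z hz => hker z fun _ _ => ⟨1, 0, by simpa using hz⟩
  have hpow : ∀ (k : ℕ) (z : M), p ^ k • z = 0 → z = 0 := by
    intro k
    induction k with
    | zero => simp
    | succ k ih => exact fun z hz => hpM z (ih _ (by rwa [smul_smul, ← pow_succ]))
  have hpφ : ∀ i, ¬ p ∣ φ i := by
    rintro i ⟨c, hc⟩
    obtain ⟨n, a, b, h⟩ := hxφ i
    exact hpx (hp.dvd_of_dvd_pow (n := n) ⟨a + b * c, by rw [h, hc]; ring⟩)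
  obtain ⟨r, f, hf, k, hk⟩ := exists_linearMap_fin_saturated hm hp.ne_zero
    (fun a b h => (hp.dvd_or_dvd ⟨b, h⟩).resolve_left hpx) M
  obtain ⟨c, hc0, hc⟩ : ∃ c : A, c ≠ 0 ∧ ∀ z : LinearMap.ker f, c • z = 0 := by
    have htors : Module.IsTorsion A (LinearMap.ker f) := by
      rintro ⟨z, hz⟩
      obtain ⟨a, ha, haz⟩ := (hf z).1 hz
      exact ⟨⟨a, mem_nonZeroDivisors_of_ne_zero ha⟩, Subtype.ext haz⟩
    obtain ⟨c, hc, hc'⟩ := Submodule.annihilator_top_inter_nonZeroDivisors htors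
    exact ⟨c, nonZeroDivisors.ne_zero hc', fun z => Submodule.mem_annihilator.1 hc z trivial⟩
  obtain ⟨I, hIE, hI⟩ := exists_prod_smul_torsion_eq_zero hp hmφ hpm hpφ hpair E hker hc0
  obtain ⟨J, t, g, hJI, ht, hg, K, hK⟩ := exists_linearMap_pi_quotient_pos hpm hmφ hpair
    (LinearMap.ker f) (fun z hz => Subtype.ext (hpM z (congrArg Subtype.val hz))) I
    (fun z => Subtype.ext (hI z (congrArg Subtype.val (hc z))))
  choose b hb using fun i : Fin r => (hk (Pi.single i 1)).1
  let h : (Fin r → A) →ₗ[A] M := Fintype.linearCombination A b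
  have hfh : ∀ v, f (h v) = p ^ k • v := by
    intro v
    conv_rhs => rw [pi_eq_sum_univ' v, Finset.smul_sum]
    rw [Fintype.linearCombination_apply, map_sum]
    refine Finset.sum_congr rfl fun i _ => ?_
    rw [map_smul, hb, smul_comm]
  let π : M →ₗ[A] LinearMap.ker f :=
    (p ^ k • LinearMap.id - h ∘ₗ f).codRestrict _ fun z => by
      rw [LinearMap.mem_ker, LinearMap.sub_apply, map_sub, LinearMap.comp_apply, hfh,
        LinearMap.smul_apply, map_smul, LinearMap.id_apply, sub_self]
  have hπ : ∀ z : LinearMap.ker f, π z = p ^ k • z := by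
    rintro ⟨z, hz⟩
    apply Subtype.ext
    change p ^ k • z - h (f z) = p ^ k • z
    rw [LinearMap.mem_ker.1 hz, map_zero, sub_zero]
  refine ⟨r, J, t, fun i hi => hIE i (hJI hi), ht, f.prod (g ∘ₗ π), ?_, ?_⟩
  · rw [injective_iff_map_eq_zero]
    intro z hz
    have hz1 : f z = 0 := congrArg Prod.fst hz
    have hz2 : g (π z) = 0 := congrArg Prod.snd hz
    have hz3 := hπ ⟨z, hz1⟩
    rw [(injective_iff_map_eq_zero g).1 hg _ hz2] at hz3
    exact hpow k z (congrArg Subtype.val hz3.symm)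
  · have hkill : ∀ a d : A, (∀ v, ∃ z, f z = a • v) →
        (∀ w, ∃ z : LinearMap.ker f, g (π z) = d • w) → ∀ u :
          ((Fin r → A) × ((i : J) → Fin (t i) → A ⧸ Ideal.span {φ i})) ⧸
            LinearMap.range (f.prod (g ∘ₗ π)), (d * a) • u = 0 := by
      intro a d ha hd u
      obtain ⟨⟨v, w⟩, rfl⟩ := Submodule.mkQ_surjective _ u
      obtain ⟨z, hz⟩ := ha v
      obtain ⟨n, hn⟩ := hd (a • w - g (π z))
      rw [← map_smul]
      refine (Submodule.Quotient.mk_eq_zero _).2 ⟨d • z + n, Prod.ext ?_ ?_⟩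
      · change f (d • z + n) = (d * a) • v
        rw [map_add, map_smul, hz, LinearMap.mem_ker.1 n.2, add_zero, mul_smul]
      · change g (π (d • z + n)) = (d * a) • w
        rw [map_add, map_add, hn, map_smul, map_smul, smul_sub, mul_smul]
        abel
    have hpT : ∀ w, ∃ z : LinearMap.ker f, g (π z) = p ^ (k + K) • w := by
      intro w
      obtain ⟨z, hz⟩ := hK w
      exact ⟨z, by rw [hπ, map_smul, hz, pow_add, mul_smul]⟩
    obtain ⟨L, a, d, hL⟩ := exists_pow_eq_mul_add_mul_prod hxφ J (k + K)
    have hxT : ∀ w, ∃ z : LinearMap.ker f, g (π z) = x ^ L • w := by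
      intro w
      obtain ⟨z, hz⟩ := hpT (a • w)
      refine ⟨z, ?_⟩
      have h0 : (∏ i ∈ J, φ i) • w = 0 := by
        funext i s
        obtain ⟨u, hu⟩ := Ideal.Quotient.mk_surjective (w i s)
        rw [Pi.smul_apply, Pi.smul_apply, ← hu]
        exact Ideal.Quotient.eq_zero_iff_mem.2
          (Ideal.mul_mem_right _ _ (Ideal.mem_span_singleton.2 (Finset.dvd_prod_of_mem φ i.2)))
      rw [hz, hL, add_smul, mul_smul d, h0, smul_zero, add_zero, mul_comm, mul_smul]
    refine finite_of_pow_smul_eq_zero hm _ (k := k + K + k) (l := L + k) ?_ ?_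
    · rw [pow_add]
      exact hkill _ _ (fun v => (hk v).1) hpT
    · rw [pow_add]
      exact hkill _ _ (fun v => (hk v).2) hxT

end StructureTheorem

section IwasawaAlgebra

open IsLocalRing

variable (p : ℕ) [Fact p.Prime]

theorem PhiLT_eq_compRingHom (n : ℕ) :
    PhiLT p n = (Polynomial.coeToPowerSeries.ringHom.comp
      (Polynomial.compRingHom (Polynomial.X + 1))) (Polynomial.cyclotomic (p ^ n) ℤ_[p]) := rfl

theorem coe_compRingHom_X :
    (Polynomial.coeToPowerSeries.ringHom.comp
      (Polynomial.compRingHom (Polynomial.X + 1))) (Polynomial.X : Polynomial ℤ_[p]) =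
      PowerSeries.X + 1 := by
  simp

theorem PhiLT_zero : PhiLT p 0 = PowerSeries.X := by
  rw [PhiLT_eq_compRingHom, pow_zero, Polynomial.cyclotomic_one, map_sub, map_one,
    coe_compRingHom_X, add_sub_cancel_right]

theorem PhiLT_dvd_pow_sub_one {n m : ℕ} (h : n ≤ m) :
    PhiLT p n ∣ (PowerSeries.X + 1) ^ p ^ m - 1 := by
  have h1 : Polynomial.cyclotomic (p ^ n) ℤ_[p] ∣ Polynomial.X ^ p ^ m - 1 := by
    obtain ⟨k, hk⟩ := pow_dvd_pow p h
    rw [hk, pow_mul]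
    exact (Polynomial.cyclotomic.dvd_X_pow_sub_one _ _).trans (by
      simpa using sub_dvd_pow_sub_pow ((Polynomial.X : Polynomial ℤ_[p]) ^ p ^ n) 1 k)
  have h2 := map_dvd (Polynomial.coeToPowerSeries.ringHom.comp
      (Polynomial.compRingHom (Polynomial.X + 1))) h1
  rwa [map_sub, map_one, map_pow, coe_compRingHom_X, ← PhiLT_eq_compRingHom] at h2

theorem PhiLT_succ (m : ℕ) :
    PhiLT p (m + 1) = ∑ i ∈ Finset.range p, ((PowerSeries.X + 1) ^ p ^ m) ^ i := by
  rw [PhiLT_eq_compRingHom, Polynomial.cyclotomic_prime_pow_eq_geom_sum Fact.out, map_sum]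
  simp only [map_pow, coe_compRingHom_X]

theorem exists_PhiLT_eq_add_mul {n n' : ℕ} (h : n < n') :
    ∃ c, PhiLT p n' = (p : PowerSeries ℤ_[p]) + PhiLT p n * c := by
  obtain ⟨m, rfl⟩ := Nat.exists_eq_add_one_of_ne_zero (Nat.ne_zero_of_lt h)
  have h1 := PhiLT_dvd_pow_sub_one p (Nat.lt_succ_iff.1 h)
  have h2 : PhiLT p n ∣ PhiLT p (m + 1) - (p : PowerSeries ℤ_[p]) := by
    have : PhiLT p (m + 1) - (p : PowerSeries ℤ_[p]) =
        ∑ i ∈ Finset.range p, (((PowerSeries.X + 1) ^ p ^ m) ^ i - 1) := by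
      rw [PhiLT_succ, Finset.sum_sub_distrib]
      simp
    rw [this]
    refine Finset.dvd_sum fun i _ => h1.trans ?_
    simpa using sub_dvd_pow_sub_pow ((PowerSeries.X + 1) ^ p ^ m : PowerSeries ℤ_[p]) 1 i
  obtain ⟨c, hc⟩ := h2
  exact ⟨c, by rw [← hc]; ring⟩

theorem exists_X_pow_eq (n : ℕ) :
    ∃ (k : ℕ) (a b : PowerSeries ℤ_[p]),
      PowerSeries.X ^ k = a * (p : PowerSeries ℤ_[p]) + b * PhiLT p n := by
  obtain ⟨r, hr⟩ := exists_add_pow_prime_pow_eq (p := p) Fact.out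
    (PowerSeries.X : PowerSeries ℤ_[p]) 1 n
  obtain ⟨c, hc⟩ := PhiLT_dvd_pow_sub_one p (le_refl n)
  refine ⟨p ^ n, -(PowerSeries.X * r), c, ?_⟩
  rw [hr, one_pow] at hc
  linear_combination hc

theorem maximalIdeal_powerSeries_padicInt :
    maximalIdeal (PowerSeries ℤ_[p]) = Ideal.span {(p : PowerSeries ℤ_[p]), PowerSeries.X} := by
  have hm : ∀ f : PowerSeries ℤ_[p], f ∈ maximalIdeal (PowerSeries ℤ_[p]) ↔
      (p : ℤ_[p]) ∣ PowerSeries.constantCoeff f := fun f => by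
    rw [mem_maximalIdeal, mem_nonunits_iff, PowerSeries.isUnit_iff_constantCoeff,
      ← mem_nonunits_iff, ← mem_maximalIdeal, PadicInt.maximalIdeal_eq_span_p,
      Ideal.mem_span_singleton]
  apply le_antisymm
  · intro f hf
    obtain ⟨a, ha⟩ := (hm f).1 hf
    obtain ⟨g, hg⟩ : PowerSeries.X ∣ f - PowerSeries.C (PowerSeries.constantCoeff f) := by
      rw [PowerSeries.X_dvd_iff]
      simp
    rw [Ideal.mem_span_pair]
    refine ⟨PowerSeries.C a, g, ?_⟩
    rw [mul_comm g, ← hg, ha, map_mul, map_natCast]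
    ring
  · rw [Ideal.span_le]
    rintro f (rfl | rfl)
    · exact (hm _).2 (by simp)
    · exact (hm _).2 (by simp)

theorem maximalIdeal_eq_span_PhiLT (n : ℕ) :
    maximalIdeal (PowerSeries ℤ_[p]) =
      Ideal.span {(if n = 0 then (p : PowerSeries ℤ_[p]) else PowerSeries.X), PhiLT p n} := by
  rw [maximalIdeal_powerSeries_padicInt]
  by_cases hn : n = 0
  · subst hn
    rw [if_pos rfl, PhiLT_zero]
  · obtain ⟨c, hc⟩ := exists_PhiLT_eq_add_mul p (Nat.pos_of_ne_zero hn)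
    rw [PhiLT_zero] at hc
    rw [if_neg hn, hc, Ideal.span_pair_comm, mul_comm, Ideal.span_pair_add_mul_left]

instance finite_residueField_powerSeries_padicInt :
    Finite (ResidueField (PowerSeries ℤ_[p])) := by
  have hfin : Finite (ZMod p) := inferInstance
  let g : ZMod p → ResidueField (PowerSeries ℤ_[p]) := fun a => ((a.val : ℕ) : ResidueField _)
  refine Finite.of_surjective g fun y => ?_
  obtain ⟨f, rfl⟩ := residue_surjective y
  refine ⟨PadicInt.toZMod (PowerSeries.constantCoeff f), ?_⟩
  rw [← sub_eq_zero]
  simp only [g]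
  rw [← map_natCast (residue (PowerSeries ℤ_[p])), ← map_sub, residue_eq_zero_iff,
    mem_maximalIdeal, mem_nonunits_iff, PowerSeries.isUnit_iff_constantCoeff, ← mem_nonunits_iff,
    ← mem_maximalIdeal, ← PadicInt.ker_toZMod, RingHom.mem_ker,
    map_sub, map_sub, map_natCast, map_natCast, ZMod.natCast_zmod_val, sub_self]

theorem natCast_dvd_powerSeries_iff (f : PowerSeries ℤ_[p]) :
    (p : PowerSeries ℤ_[p]) ∣ f ↔ PowerSeries.map PadicInt.toZMod f = 0 := by
  constructor
  · rintro ⟨g, rfl⟩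
    rw [map_mul, map_natCast, ← map_natCast PowerSeries.C, ZMod.natCast_self, map_zero, zero_mul]
  · intro h
    have h1 : ∀ n, (p : ℤ_[p]) ∣ PowerSeries.coeff n f := fun n => by
      rw [← Ideal.mem_span_singleton, ← PadicInt.maximalIdeal_eq_span_p, ← PadicInt.ker_toZMod,
        RingHom.mem_ker, ← PowerSeries.coeff_map, h, map_zero]
    choose g hg using h1
    refine ⟨PowerSeries.mk g, ?_⟩
    ext n
    rw [← map_natCast PowerSeries.C, PowerSeries.coeff_C_mul, PowerSeries.coeff_mk, hg]

theorem prime_natCast_powerSeries : Prime (p : PowerSeries ℤ_[p]) := by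
  refine ⟨?_, ?_, ?_⟩
  · rw [← map_natCast PowerSeries.C, Ne, map_eq_zero_iff _ PowerSeries.C_injective]
    exact_mod_cast (Fact.out : p.Prime).ne_zero
  · intro h
    have := (natCast_dvd_powerSeries_iff p 1).1 h.dvd
    simp at this
  · intro a b
    simp only [natCast_dvd_powerSeries_iff, map_mul, mul_eq_zero]
    exact id

theorem not_natCast_dvd_X : ¬ (p : PowerSeries ℤ_[p]) ∣ PowerSeries.X := by
  rw [natCast_dvd_powerSeries_iff, PowerSeries.map_X]
  exact PowerSeries.X_ne_zero

theorem exists_eq_mul_PhiLT_add_mul_PhiLT (i j : ℕ) (hij : i ≠ j) :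
    ∃ a b, (p : PowerSeries ℤ_[p]) = a * PhiLT p i + b * PhiLT p j := by
  rcases lt_or_gt_of_ne hij with h | h
  · obtain ⟨c, hc⟩ := exists_PhiLT_eq_add_mul p h
    exact ⟨-c, 1, by rw [hc]; ring⟩
  · obtain ⟨c, hc⟩ := exists_PhiLT_eq_add_mul p h
    exact ⟨1, -c, by rw [hc]; ring⟩

theorem omegaPlus_mem_maximalIdeal_pow (i : ℕ) :
    omegaPlus p (2 * i) ∈ maximalIdeal (PowerSeries ℤ_[p]) ^ i := by
  have h : ∏ n ∈ (Finset.range (2 * i + 1)).filter (fun n => Even n), PhiLT p n ∈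
      ∏ n ∈ (Finset.range (2 * i + 1)).filter (fun n => Even n),
        maximalIdeal (PowerSeries ℤ_[p]) := by
    refine Ideal.prod_mem_prod fun n _ => ?_
    rw [maximalIdeal_eq_span_PhiLT p n]
    exact Ideal.subset_span (by simp)
  rw [Finset.prod_const] at h
  refine Ideal.pow_le_pow_right ?_ h
  have hsub : (Finset.range i).image (fun n => 2 * n) ⊆
      (Finset.range (2 * i + 1)).filter (fun n => Even n) := by
    intro n hn
    obtain ⟨m, hm, rfl⟩ := Finset.mem_image.1 hn
    have := Finset.mem_range.1 hm
    exact Finset.mem_filter.2 ⟨Finset.mem_range.2 (by omega), even_two_mul m⟩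
  have hcard := Finset.card_le_card hsub
  rwa [Finset.card_image_of_injective _ (fun a b hab => by simpa using hab),
    Finset.card_range] at hcard

theorem eq_zero_of_forall_mem_omegaPlus_smul (M : Type*) [AddCommGroup M]
    [Module (PowerSeries ℤ_[p]) M] [Module.Finite (PowerSeries ℤ_[p]) M] (z : M)
    (hz : ∀ m, z ∈ (Ideal.span {omegaPlus p m} • ⊤ : Submodule (PowerSeries ℤ_[p]) M)) :
    z = 0 := by
  rw [← Submodule.mem_bot (PowerSeries ℤ_[p]), ← Ideal.iInf_pow_smul_eq_bot_of_isLocalRing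
    (maximalIdeal (PowerSeries ℤ_[p])) (Ideal.IsPrime.ne_top'), Submodule.mem_iInf]
  intro i
  refine Submodule.smul_mono_left ?_ (hz (2 * i))
  rw [Ideal.span_singleton_le_iff_mem]
  exact omegaPlus_mem_maximalIdeal_pow p i

end IwasawaAlgebra

/-- structure theorem, after Lee: let `X` be a finitely generated `Λ`-module
such that (i) the `p`-power torsion of `X/ω_m⁺X` is finite for all `m`, and (ii) for every `m`
there is `m' ≥ m` such that the induced map on `p`-power torsion
`(X/ω_{m'}⁺X)[p^∞] → (X/ω_m⁺X)[p^∞]` is zero. Then there exist `r ≥ 0`, a finite set `I` of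
even non-negative integers, integers `t_n ≥ 1`, and an injective `Λ`-homomorphism
`X → Λ^r ⊕ ⊕_{n ∈ I} (Λ/Φ_n)^{t_n}` with finite cokernel. -/
theorem statement4 (p : ℕ) [Fact p.Prime] (hp : Odd p)
    (X : Type*) [AddCommGroup X] [Module (PowerSeries ℤ_[p]) X]
    [Module.Finite (PowerSeries ℤ_[p]) X]
    (hfin : ∀ m : ℕ,
      ({x : X ⧸ (Ideal.span {omegaPlus p m} • ⊤ : Submodule (PowerSeries ℤ_[p]) X) |
        ∃ k : ℕ, p ^ k • x = 0}).Finite)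
    (hzero : ∀ m : ℕ, ∃ m' : ℕ, m ≤ m' ∧
      ∀ x : X,
        (∃ k : ℕ, p ^ k • (Submodule.Quotient.mk x :
          X ⧸ (Ideal.span {omegaPlus p m'} • ⊤ : Submodule (PowerSeries ℤ_[p]) X)) = 0) →
        (Submodule.Quotient.mk x :
          X ⧸ (Ideal.span {omegaPlus p m} • ⊤ : Submodule (PowerSeries ℤ_[p]) X)) = 0) :
    ∃ (r : ℕ) (I : Finset ℕ) (t : ℕ → ℕ),
      (∀ n ∈ I, Even n) ∧ (∀ n ∈ I, 1 ≤ t n) ∧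
      ∃ ι : X →ₗ[PowerSeries ℤ_[p]]
          ((Fin r → PowerSeries ℤ_[p]) ×
            ((n : I) → Fin (t n) → (PowerSeries ℤ_[p] ⧸ Ideal.span {PhiLT p n}))),
        Function.Injective ι ∧
        Finite
          (((Fin r → PowerSeries ℤ_[p]) ×
            ((n : I) → Fin (t n) → (PowerSeries ℤ_[p] ⧸ Ideal.span {PhiLT p n}))) ⧸
            LinearMap.range ι) := by
  have hker : ∀ z : X, (∀ s : Finset ℕ, (∀ i ∈ s, i ∈ {n | Even n}) →
      ∃ (k : ℕ) (w : X), (p : PowerSeries ℤ_[p]) ^ k • z = (∏ i ∈ s, PhiLT p i) • w) → z = 0 := by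
    intro z hz
    refine eq_zero_of_forall_mem_omegaPlus_smul p X z fun m => ?_
    obtain ⟨m', -, hm'⟩ := hzero m
    obtain ⟨k, w, hw⟩ := hz ((Finset.range (m' + 1)).filter fun n => Even n)
      fun i hi => (Finset.mem_filter.1 hi).2
    refine (Submodule.Quotient.mk_eq_zero _).1 (hm' z ⟨k, ?_⟩)
    rw [← Submodule.Quotient.mk_smul, Submodule.Quotient.mk_eq_zero,
      ← Nat.cast_smul_eq_nsmul (PowerSeries ℤ_[p]), Nat.cast_pow, hw]
    exact Submodule.smul_mem_smul (Ideal.mem_span_singleton_self _) trivial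
  exact exists_injective_finite_cokernel (prime_natCast_powerSeries p)
    (maximalIdeal_powerSeries_padicInt p) (not_natCast_dvd_X p) (maximalIdeal_eq_span_PhiLT p)
    (exists_eq_mul_PhiLT_add_mul_PhiLT p) (exists_X_pow_eq p) {n | Even n} X hker
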